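/- arXiv:1303.0876 — 3 statements merged into one kernel-verified Lean document; each statement's English description precedes it below -/
import Mathlib

section
/- Let a be a real number with −3 − 2√2 < a < −3 + 2√2. For every real number x, |(−x² + (1+a)x)/a| < 1 holds if and only if a < x < 1. -/
/-- Convergence region of the infinite Heun series for
`-3 - 2√2 < a < -3 + 2√2`. -/
theorem heun_convergence_region_a_between_roots
    (a : ℝ) (ha1 : -3 - 2 * Real.sqrt 2 < a) (ha2 : a < -3 + 2 * Real.sqrt 2) :
    ∀ x : ℝ, |(-x ^ 2 + (1 + a) * x) / a| < 1 ↔ (a < x ∧ x < 1) := by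
  intro x
  have hsqrt : Real.sqrt 2 ^ 2 = 2 := Real.sq_sqrt (by norm_num)
  have hdisc : a ^ 2 + 6 * a + 1 < 0 := by
    nlinarith [mul_pos (sub_pos.2 ha1) (sub_pos.2 ha2)]
  have ha : a < 0 := by nlinarith [sq_nonneg a]
  rw [abs_div, div_lt_one (abs_pos.2 ha.ne), abs_of_neg ha, abs_lt, neg_neg]
  constructor
  · rintro ⟨h, -⟩
    have hprod : 0 < (x - a) * (1 - x) := by linarith
    rcases mul_pos_iff.1 hprod with ⟨h₁, h₂⟩ | ⟨h₁, h₂⟩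
    · exact ⟨by linarith, by linarith⟩
    · linarith
  · rintro ⟨h₁, h₂⟩
    exact ⟨by linarith [mul_pos (sub_pos.2 h₁) (sub_pos.2 h₂)],
      by nlinarith [sq_nonneg (2 * x - (1 + a))]⟩
end

section
/- Let a be a real number with either −3 + 2√2 < a < 0 or a < −3 − 2√2. For every real number x, |(−x² + (1+a)x)/a| < 1 holds if and only if ( a < x < ((1+a) − √(a² + 6a + 1))/2 ) or ( ((1+a) + √(a² + 6a + 1))/2 < x < 1 ). -/
/-- Convergence region of the infinite Heun series for negative `a` with
`a² + 6a + 1 > 0`, i.e. `-3 + 2√2 < a < 0` or `a < -3 - 2√2`. -/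
theorem heun_convergence_region_a_neg_outside_roots
    (a : ℝ) (ha : (-3 + 2 * Real.sqrt 2 < a ∧ a < 0) ∨ a < -3 - 2 * Real.sqrt 2) :
    ∀ x : ℝ, |(-x ^ 2 + (1 + a) * x) / a| < 1 ↔
      (a < x ∧ x < ((1 + a) - Real.sqrt (a ^ 2 + 6 * a + 1)) / 2) ∨
      (((1 + a) + Real.sqrt (a ^ 2 + 6 * a + 1)) / 2 < x ∧ x < 1) := by
  intro x
  have h2 : Real.sqrt 2 ^ 2 = 2 := Real.sq_sqrt (by norm_num)
  have h2pos : 0 < Real.sqrt 2 := by positivity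
  have ha0 : a < 0 := by
    rcases ha with h | h
    · exact h.2
    · linarith
  have hdisc : 0 ≤ a ^ 2 + 6 * a + 1 := by
    rcases ha with ⟨h, -⟩ | h <;> nlinarith
  have hs := Real.sq_sqrt hdisc
  have hs0 := Real.sqrt_nonneg (a ^ 2 + 6 * a + 1)
  set s := Real.sqrt (a ^ 2 + 6 * a + 1)
  have hfac : x ^ 2 - (1 + a) * x - a = (x - ((1 + a) - s) / 2) * (x - ((1 + a) + s) / 2) := by
    linear_combination hs / 4
  rw [abs_lt, lt_div_iff_of_neg ha0, div_lt_iff_of_neg ha0]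
  constructor
  · rintro ⟨hlt, hgt⟩
    have hax : a < x := by
      by_contra! h
      nlinarith [mul_nonneg (sub_nonneg.2 h) (by linarith : 0 ≤ 1 - x)]
    have hx1 : x < 1 := by
      by_contra! h
      nlinarith [mul_nonneg (sub_nonneg.2 h) (by linarith : 0 ≤ x - a)]
    have hpos : 0 < (x - ((1 + a) - s) / 2) * (x - ((1 + a) + s) / 2) := by
      rw [← hfac]
      linarith
    rcases mul_pos_iff.1 hpos with ⟨-, h⟩ | ⟨h, -⟩
    · exact Or.inr ⟨by linarith, hx1⟩
    · exact Or.inl ⟨hax, by linarith⟩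
  · intro h
    have hbounds : a < x ∧ x < 1 := by
      rcases h with h | h
      · exact ⟨h.1, by linarith⟩
      · exact ⟨by linarith, h.2⟩
    have hpos : 0 < (x - ((1 + a) - s) / 2) * (x - ((1 + a) + s) / 2) := by
      rcases h with h | h
      · exact mul_pos_of_neg_of_neg (by linarith) (by linarith)
      · exact mul_pos (by linarith) (by linarith)
    have hroots := mul_pos (sub_pos.2 hbounds.1) (sub_pos.2 hbounds.2)
    constructor <;> linarith
end

section
/- Let m be a natural number, let a', b ∈ ℂ with (a')_m ≠ 0 and (b)_m ≠ 0, let p, q be real numbers with p > 0, q > 0, p − 1 + m > 0 and q − 1 + m > 0, and let z ∈ ℂ with |z| < 1. Then both series below converge absolutely and Σ_{i=m}^{∞} [ ((a')_i · (b)_i · (p)_m · (q)_m) / ((a')_m · (b)_m · (p)_i · (q)_i) ] · z^i = z^m · (p − 1 + m)·(q − 1 + m) · Σ_{j=0}^{∞} B(p − 1 + m, j + 1) · B(q − 1 + m, j + 1) · [ ((m + a')_j · (m + b)_j) / ((1)_j · j!) ] · z^j. -/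
/-- The rising factorial (Pochhammer symbol) `(x)ₙ = x (x+1) ⋯ (x+n-1)` in `ℂ`. -/
noncomputable def poch (x : ℂ) (n : ℕ) : ℂ := Polynomial.eval x (ascPochhammer ℂ n)

open Filter Topology in
theorem summable_norm_ascPochhammer_ratio (a b c d z : ℂ) (hz : ‖z‖ < 1) :
    Summable (fun n : ℕ => ‖poch a n * poch b n / (poch c n * poch d n) * z ^ n‖) := by
  obtain ⟨r, hzr, hr⟩ := exists_between hz
  have hratio (x y : ℂ) : Tendsto (fun n : ℕ => (x + n) / (y + n)) atTop (𝓝 1) := by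
    simpa using tendsto_add_mul_div_add_mul_atTop_nhds x y (1 : ℂ) (one_ne_zero (α := ℂ))
  have hlim : Tendsto (fun n : ℕ => ‖(a + n) / (c + n) * ((b + n) / (d + n)) * z‖)
      atTop (𝓝 ‖z‖) := by
    simpa using (((hratio a c).mul (hratio b d)).mul_const z).norm
  refine summable_of_ratio_norm_eventually_le hr ?_
  filter_upwards [hlim.eventually_le_const hzr] with n hn
  have hstep : poch a (n + 1) * poch b (n + 1) / (poch c (n + 1) * poch d (n + 1)) * z ^ (n + 1) =
      ((a + n) / (c + n) * ((b + n) / (d + n)) * z) *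
        (poch a n * poch b n / (poch c n * poch d n) * z ^ n) := by
    simp only [poch, ascPochhammer_succ_eval, div_eq_mul_inv, mul_inv]
    ring
  rw [norm_norm, norm_norm, hstep, norm_mul]
  exact mul_le_mul_of_nonneg_right hn (norm_nonneg _)

theorem poch_add (x : ℂ) (m n : ℕ) : poch x (m + n) = poch x m * poch (m + x) n := by
  simp [poch, ← ascPochhammer_mul, Polynomial.eval_comp, add_comm]

theorem poch_ofReal_ne_zero {x : ℝ} (hx : 0 < x) (n : ℕ) : poch x n ≠ 0 := by
  rw [poch, Ne, ascPochhammer_eval_eq_zero_iff]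
  rintro ⟨k, -, hk⟩
  have : (k : ℝ) = -x := by exact_mod_cast hk
  linarith [k.cast_nonneg (α := ℝ)]

theorem prod_range_succ_add_eq_mul_poch (u : ℂ) (n : ℕ) :
    ∏ k ∈ Finset.range (n + 1), (u + k) = u * poch (u + 1) n := by
  induction n with
  | zero => simp [poch]
  | succ n ih =>
    rw [Finset.prod_range_succ, ih]
    simp only [poch, ascPochhammer_succ_eval]
    push_cast
    ring

theorem betaIntegral_eq_factorial_div_poch {u : ℂ} (hu : 0 < u.re) (n : ℕ) :
    Complex.betaIntegral u (n + 1) = (n.factorial : ℂ) / (u * poch (u + 1) n) := by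
  rw [Complex.betaIntegral_eval_nat_add_one_right hu, prod_range_succ_add_eq_mul_poch]

/-- identity `M_l`, eq. (312): the tail of a generalized hypergeometric
series rewritten as a series with Beta-function coefficients; both series converge
absolutely for `‖z‖ < 1`. -/
theorem heun_hypergeometric_tail_eq_beta_series
    (m : ℕ) (a' b : ℂ) (ha' : poch a' m ≠ 0) (hb : poch b m ≠ 0)
    (p q : ℝ) (hp : 0 < p) (hq : 0 < q)
    (hpm : 0 < p - 1 + m) (hqm : 0 < q - 1 + m)
    (z : ℂ) (hz : ‖z‖ < 1) :
    Summable (fun i : ℕ =>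
        ‖(poch a' (m + i) * poch b (m + i) * poch (p : ℂ) m * poch (q : ℂ) m) /
            (poch a' m * poch b m * poch (p : ℂ) (m + i) * poch (q : ℂ) (m + i)) *
          z ^ (m + i)‖) ∧
    Summable (fun j : ℕ =>
        ‖Complex.betaIntegral ((p - 1 + m : ℝ) : ℂ) ((j : ℂ) + 1) *
            Complex.betaIntegral ((q - 1 + m : ℝ) : ℂ) ((j : ℂ) + 1) *
            ((poch ((m : ℂ) + a') j * poch ((m : ℂ) + b) j) /
              (poch 1 j * (Nat.factorial j : ℂ))) * z ^ j‖) ∧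
    (∑' i : ℕ,
        (poch a' (m + i) * poch b (m + i) * poch (p : ℂ) m * poch (q : ℂ) m) /
            (poch a' m * poch b m * poch (p : ℂ) (m + i) * poch (q : ℂ) (m + i)) *
          z ^ (m + i)) =
      z ^ m * (((p - 1 + m : ℝ) : ℂ) * ((q - 1 + m : ℝ) : ℂ)) *
        ∑' j : ℕ,
          Complex.betaIntegral ((p - 1 + m : ℝ) : ℂ) ((j : ℂ) + 1) *
            Complex.betaIntegral ((q - 1 + m : ℝ) : ℂ) ((j : ℂ) + 1) *
            ((poch ((m : ℂ) + a') j * poch ((m : ℂ) + b) j) /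
              (poch 1 j * (Nat.factorial j : ℂ))) * z ^ j := by
  have hleft (i : ℕ) :
      (poch a' (m + i) * poch b (m + i) * poch (p : ℂ) m * poch (q : ℂ) m) /
          (poch a' m * poch b m * poch (p : ℂ) (m + i) * poch (q : ℂ) (m + i)) * z ^ (m + i) =
        z ^ m * (poch (m + a') i * poch (m + b) i / (poch (m + p) i * poch (m + q) i) *
          z ^ i) := by
    have hpne := poch_ofReal_ne_zero hp m
    have hqne := poch_ofReal_ne_zero hq m
    rw [poch_add a', poch_add b, poch_add (p : ℂ), poch_add (q : ℂ), pow_add]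
    generalize poch (m + p) i = P
    generalize poch (m + q) i = Q
    rw [show poch a' m * poch (m + a') i * (poch b m * poch (m + b) i) * poch p m * poch q m /
        (poch a' m * poch b m * (poch p m * P) * (poch q m * Q)) =
        poch (m + a') i * poch (m + b) i / (P * Q) by
      rw [← mul_div_mul_left (poch (m + a') i * poch (m + b) i) (P * Q)
        (mul_ne_zero (mul_ne_zero ha' hb) (mul_ne_zero hpne hqne))]
      congr 1 <;> ring]
    ring
  have hune : ((p - 1 + m : ℝ) : ℂ) ≠ 0 := Complex.ofReal_ne_zero.2 hpm.ne'
  have hvne : ((q - 1 + m : ℝ) : ℂ) ≠ 0 := Complex.ofReal_ne_zero.2 hqm.ne'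
  have hright (j : ℕ) :
      Complex.betaIntegral ((p - 1 + m : ℝ) : ℂ) ((j : ℂ) + 1) *
          Complex.betaIntegral ((q - 1 + m : ℝ) : ℂ) ((j : ℂ) + 1) *
          ((poch ((m : ℂ) + a') j * poch ((m : ℂ) + b) j) /
            (poch 1 j * (Nat.factorial j : ℂ))) * z ^ j =
        (((p - 1 + m : ℝ) : ℂ) * ((q - 1 + m : ℝ) : ℂ))⁻¹ *
          (poch (m + a') j * poch (m + b) j / (poch (m + p) j * poch (m + q) j) * z ^ j) := by
    have hfact : (j.factorial : ℂ) ≠ 0 := Nat.cast_ne_zero.2 j.factorial_ne_zero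
    have hone : poch 1 j = j.factorial := ascPochhammer_eval_one ℂ j
    have hshift (x : ℝ) : ((x - 1 + m : ℝ) : ℂ) + 1 = m + x := by push_cast; ring
    rw [betaIntegral_eq_factorial_div_poch (by simpa only [Complex.ofReal_re] using hpm),
      betaIntegral_eq_factorial_div_poch (by simpa only [Complex.ofReal_re] using hqm),
      hone, hshift, hshift]
    field_simp
  have hsum := summable_norm_ascPochhammer_ratio (m + a') (m + b) (m + p) (m + q) z hz
  simp only [hleft, hright, norm_mul (z ^ m), norm_mul (_ ⁻¹ : ℂ)]
  refine ⟨hsum.mul_left _, hsum.mul_left _, ?_⟩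
  rw [tsum_mul_left, tsum_mul_left, mul_assoc, mul_inv_cancel_left₀ (mul_ne_zero hune hvne)]
end
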